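/- arXiv:1410.7067 — 3 statements merged into one kernel-verified Lean document; each statement's English description precedes it below -/
import Mathlib

section
/- Let ψ be a unit vector in ℂ²⊗ℂ²⊗ℂ² (a pure three-qubit state with density matrix ρ_ABC = |ψ⟩⟨ψ|). Then the residual correlation δ_RC, defined as the infimum of D_RC(A:B:C) over all orthonormal bases {|u₁⟩,|u₂⟩} of ℂ² (measurement on B) and all orthonormal bases {|v₁⟩,…,|v₄⟩} of ℂ²⊗ℂ² (measurement on AB), equals S(ρ_B) + inf S(ρ_{A|Π^B}), where the latter infimum is over all orthonormal bases {|u₁⟩,|u₂⟩} of ℂ². -/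
open scoped BigOperators ComplexOrder
open Matrix

noncomputable section

abbrev Q2 := Fin 2
abbrev Q4 := Fin 2 × Fin 2
abbrev Q3 := Fin 2 × Fin 2 × Fin 2

/-- A density matrix: positive semidefinite (hence Hermitian) with unit trace. -/
def IsDensityMatrix {n : Type*} [Fintype n] [DecidableEq n] (ρ : Matrix n n ℂ) : Prop :=
  ρ.PosSemidef ∧ ρ.trace = 1

/-- Von Neumann entropy `S(ρ) = -∑ λᵢ log λᵢ` (eigenvalues of a Hermitian matrix),
with the convention `0 log 0 = 0`. -/
noncomputable def vN {n : Type*} [Fintype n] [DecidableEq n] (ρ : Matrix n n ℂ) : ℝ :=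
  if h : ρ.IsHermitian then ∑ i, Real.negMulLog (h.eigenvalues i) else 0

/-- Rank-one projector `|u⟩⟨u|`. -/
def proj {n : Type*} (u : n → ℂ) : Matrix n n ℂ := fun i j => u i * star (u j)

/-- An orthonormal family of vectors (an orthonormal basis when `card ι = card n`). -/
def OrthonormalFamily {ι n : Type*} [DecidableEq ι] [Fintype n] (u : ι → n → ℂ) : Prop :=
  ∀ i j, (∑ k, star (u i k) * u j k) = if i = j then (1 : ℂ) else 0

/-- A unit vector. -/
def IsUnitVec {n : Type*} [Fintype n] (u : n → ℂ) : Prop :=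
  (∑ k, star (u k) * u k) = 1

/-- Reduced state of subsystem A. -/
def rhoA (ρ : Matrix Q3 Q3 ℂ) : Matrix Q2 Q2 ℂ := fun a a' => ∑ b, ∑ c, ρ (a, b, c) (a', b, c)
/-- Reduced state of subsystem B. -/
def rhoB (ρ : Matrix Q3 Q3 ℂ) : Matrix Q2 Q2 ℂ := fun b b' => ∑ a, ∑ c, ρ (a, b, c) (a, b', c)
/-- Reduced state of subsystem C. -/
def rhoC (ρ : Matrix Q3 Q3 ℂ) : Matrix Q2 Q2 ℂ := fun c c' => ∑ a, ∑ b, ρ (a, b, c) (a, b, c')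
/-- Reduced state of subsystems AB. -/
def rhoAB (ρ : Matrix Q3 Q3 ℂ) : Matrix Q4 Q4 ℂ := fun x y => ∑ c, ρ (x.1, x.2, c) (y.1, y.2, c)
/-- Reduced state of subsystems BC. -/
def rhoBC (ρ : Matrix Q3 Q3 ℂ) : Matrix Q4 Q4 ℂ := fun x y => ∑ a, ρ (a, x.1, x.2) (a, y.1, y.2)
/-- Reduced state of subsystems AC. -/
def rhoAC (ρ : Matrix Q3 Q3 ℂ) : Matrix Q4 Q4 ℂ := fun x y => ∑ b, ρ (x.1, b, x.2) (y.1, b, y.2)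

/-- `I ⊗ π ⊗ I`: an operator acting on subsystem B only. -/
def opB (π : Matrix Q2 Q2 ℂ) : Matrix Q3 Q3 ℂ :=
  fun x y => (if x.1 = y.1 then (1 : ℂ) else 0) * π x.2.1 y.2.1 *
    (if x.2.2 = y.2.2 then (1 : ℂ) else 0)

/-- `π ⊗ I`: an operator acting on subsystems AB only. -/
def opAB (π : Matrix Q4 Q4 ℂ) : Matrix Q3 Q3 ℂ :=
  fun x y => π (x.1, x.2.1) (y.1, y.2.1) * (if x.2.2 = y.2.2 then (1 : ℂ) else 0)

/-- Outcome probability `pⱼ = Tr((I⊗πⱼ⊗I)ρ)` for measurement of B in basis `u`. -/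
def pB (ρ : Matrix Q3 Q3 ℂ) (u : Fin 2 → Q2 → ℂ) (j : Fin 2) : ℝ :=
  ((opB (proj (u j)) * ρ).trace).re

/-- Conditional state of A given outcome `j` of the measurement on B. -/
def condA (ρ : Matrix Q3 Q3 ℂ) (u : Fin 2 → Q2 → ℂ) (j : Fin 2) : Matrix Q2 Q2 ℂ :=
  ((pB ρ u j : ℂ))⁻¹ • rhoA (opB (proj (u j)) * ρ * opB (proj (u j)))

/-- Average conditional entropy `S(ρ_{A|Π^B}) = ∑_{j : pⱼ>0} pⱼ S(ρ_{A|j})`. -/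
def SAcondB (ρ : Matrix Q3 Q3 ℂ) (u : Fin 2 → Q2 → ℂ) : ℝ :=
  ∑ j, if 0 < pB ρ u j then pB ρ u j * vN (condA ρ u j) else 0

/-- Outcome probability `pⱼ = Tr((πⱼ⊗I)ρ)` for measurement of AB in basis `v`. -/
def pAB (ρ : Matrix Q3 Q3 ℂ) (v : Fin 4 → Q4 → ℂ) (j : Fin 4) : ℝ :=
  ((opAB (proj (v j)) * ρ).trace).re

/-- Conditional state of C given outcome `j` of the measurement on AB. -/
def condC (ρ : Matrix Q3 Q3 ℂ) (v : Fin 4 → Q4 → ℂ) (j : Fin 4) : Matrix Q2 Q2 ℂ :=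
  ((pAB ρ v j : ℂ))⁻¹ • rhoC (opAB (proj (v j)) * ρ * opAB (proj (v j)))

/-- Average conditional entropy `S(ρ_{C|Π^{AB}}) = ∑_{j : pⱼ>0} pⱼ S(ρ_{C|j})`. -/
def SCcondAB (ρ : Matrix Q3 Q3 ℂ) (v : Fin 4 → Q4 → ℂ) : ℝ :=
  ∑ j, if 0 < pAB ρ v j then pAB ρ v j * vN (condC ρ v j) else 0

/-- `𝓘₀(A:B:C)`: mutual information with no measurement. -/
def I0 (ρ : Matrix Q3 Q3 ℂ) : ℝ :=
  vN (rhoA ρ) + vN (rhoB ρ) + vN (rhoC ρ)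
    - (vN (rhoAB ρ) + vN (rhoBC ρ) + vN (rhoAC ρ)) + vN ρ

/-- `𝓘₁(A:B:C)`: mutual information after one-particle measurement on B. -/
def I1 (ρ : Matrix Q3 Q3 ℂ) (u : Fin 2 → Q2 → ℂ) : ℝ :=
  vN (rhoA ρ) + vN (rhoC ρ) - SAcondB ρ u - vN (rhoAC ρ) - vN (rhoBC ρ) + vN ρ

/-- `𝓘₂(A:B:C)`: mutual information after two-particle measurement on AB. -/
def I2 (ρ : Matrix Q3 Q3 ℂ) (v : Fin 4 → Q4 → ℂ) : ℝ :=
  vN (rhoA ρ) + vN (rhoB ρ) + vN (rhoC ρ) - (vN (rhoBC ρ) + vN (rhoAC ρ)) + SCcondAB ρ v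

/-- Residual correlation function `D_RC = 𝓘₂ - 𝓘₁`. -/
def DRC (ρ : Matrix Q3 Q3 ℂ) (u : Fin 2 → Q2 → ℂ) (v : Fin 4 → Q4 → ℂ) : ℝ :=
  I2 ρ v - I1 ρ u

lemma proj_mul_proj {n : Type*} [Fintype n] (u : n → ℂ) :
    proj u * proj u = (∑ k, star (u k) * u k) • proj u := by
  ext i j
  simp only [Matrix.mul_apply, proj, Matrix.smul_apply, smul_eq_mul, Finset.sum_mul]
  exact Finset.sum_congr rfl fun k _ => by ring

lemma mul_proj_mul {n : Type*} [Fintype n] {M : Matrix n n ℂ} (hM : M.IsHermitian) (u : n → ℂ) :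
    M * proj u * M = proj (M *ᵥ u) := by
  have h (w : n → ℂ) : proj w = vecMulVec w (star w) := rfl
  rw [h, h, mul_vecMulVec, vecMulVec_mul, star_mulVec, hM.eq]

lemma proj_isHermitian {n : Type*} (u : n → ℂ) : (proj u).IsHermitian := by
  ext i j
  simp [proj, mul_comm]

lemma proj_posSemidef {n : Type*} [Fintype n] (u : n → ℂ) : (proj u).PosSemidef :=
  posSemidef_vecMulVec_self_star u

lemma vN_eq_zero_of_isIdempotentElem {n : Type*} [Fintype n] [DecidableEq n]
    {ρ : Matrix n n ℂ} (h : IsIdempotentElem ρ) : vN ρ = 0 := by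
  unfold vN
  split_ifs with hρ
  · refine Finset.sum_eq_zero fun i _ => ?_
    have hmem := h.spectrum_subset ℝ (hρ.eigenvalues_mem_spectrum_real i)
    rcases hmem with h0 | h1
    · simp [h0]
    · rw [Set.mem_singleton_iff.mp h1, Real.negMulLog_one]
  · rfl

lemma vN_nonneg {n : Type*} [Fintype n] [DecidableEq n] {ρ : Matrix n n ℂ}
    (hρ : IsDensityMatrix ρ) : 0 ≤ vN ρ := by
  obtain ⟨hpos, htr⟩ := hρ
  unfold vN
  rw [dif_pos hpos.isHermitian]
  have hsum : ∑ i, hpos.isHermitian.eigenvalues i = 1 := by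
    have := hpos.isHermitian.trace_eq_sum_eigenvalues
    rw [htr] at this
    exact Complex.ofReal_injective (by simpa using this.symm)
  refine Finset.sum_nonneg fun i _ => Real.negMulLog_nonneg (hpos.eigenvalues_nonneg i) ?_
  rw [← hsum]
  exact Finset.single_le_sum (fun k _ => hpos.eigenvalues_nonneg k) (Finset.mem_univ i)

lemma opAB_isHermitian {π : Matrix Q4 Q4 ℂ} (h : π.IsHermitian) : (opAB π).IsHermitian := by
  ext x y
  by_cases hc : x.2.2 = y.2.2 <;> simp [opAB, h.apply, hc, eq_comm]

lemma opB_isHermitian {π : Matrix Q2 Q2 ℂ} (h : π.IsHermitian) : (opB π).IsHermitian := by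
  ext x y
  by_cases ha : x.1 = y.1 <;> by_cases hc : x.2.2 = y.2.2 <;>
    simp [opB, h.apply, ha, hc, eq_comm]

/-- The unnormalised vector of C left after projecting AB onto `v`. -/
def partialInnerAB (v : Q4 → ℂ) (ψ : Q3 → ℂ) (c : Q2) : ℂ :=
  ∑ x : Q4, star (v x) * ψ (x.1, x.2, c)

/-- The unnormalised vector of A left after projecting B onto `u`, with C fixed to be `c`. -/
def partialInnerB (u : Q2 → ℂ) (ψ : Q3 → ℂ) (c a : Q2) : ℂ :=
  ∑ b, star (u b) * ψ (a, b, c)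

lemma opAB_proj_mulVec (v : Q4 → ℂ) (ψ : Q3 → ℂ) :
    opAB (proj v) *ᵥ ψ = fun x => v (x.1, x.2.1) * partialInnerAB v ψ x.2.2 := by
  ext ⟨a, b, c⟩
  fin_cases c <;>
  simp [opAB, proj, partialInnerAB, mulVec, dotProduct, Fintype.sum_prod_type] <;> ring

lemma opB_proj_mulVec (u : Q2 → ℂ) (ψ : Q3 → ℂ) :
    opB (proj u) *ᵥ ψ = fun x => u x.2.1 * partialInnerB u ψ x.2.2 x.1 := by
  ext ⟨a, b, c⟩
  fin_cases a <;> fin_cases c <;>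
  simp [opB, proj, partialInnerB, mulVec, dotProduct, Fintype.sum_prod_type] <;> ring

lemma rhoC_opAB_proj {v : Q4 → ℂ} (hv : IsUnitVec v) (ψ : Q3 → ℂ) :
    rhoC (opAB (proj v) * proj ψ * opAB (proj v)) = proj (partialInnerAB v ψ) := by
  rw [mul_proj_mul (opAB_isHermitian (proj_isHermitian v)), opAB_proj_mulVec]
  ext c c'
  simp only [rhoC, proj, star_mul']
  rw [← one_mul (partialInnerAB v ψ c * _), ← hv, Fintype.sum_prod_type]
  simp only [Finset.sum_mul]
  exact Finset.sum_congr rfl fun a _ => Finset.sum_congr rfl fun b _ => by ring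

lemma rhoA_opB_proj {u : Q2 → ℂ} (hu : IsUnitVec u) (ψ : Q3 → ℂ) :
    rhoA (opB (proj u) * proj ψ * opB (proj u)) = ∑ c, proj (partialInnerB u ψ c) := by
  rw [mul_proj_mul (opB_isHermitian (proj_isHermitian u)), opB_proj_mulVec]
  ext a a'
  simp only [rhoA, proj, star_mul', Matrix.sum_apply]
  rw [Finset.sum_comm]
  refine Finset.sum_congr rfl fun c _ => ?_
  rw [← one_mul (partialInnerB u ψ c a * _), ← hu, Finset.sum_mul]
  exact Finset.sum_congr rfl fun b _ => by ring

lemma trace_opAB_proj (v : Q4 → ℂ) (ψ : Q3 → ℂ) :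
    (opAB (proj v) * proj ψ).trace =
      ∑ c, star (partialInnerAB v ψ c) * partialInnerAB v ψ c := by
  change (opAB (proj v) * vecMulVec ψ (star ψ)).trace = _
  rw [mul_vecMulVec, opAB_proj_mulVec, trace_vecMulVec]
  simp [dotProduct, partialInnerAB, Fintype.sum_prod_type]
  ring

lemma trace_opB_proj (u : Q2 → ℂ) (ψ : Q3 → ℂ) :
    (opB (proj u) * proj ψ).trace = (∑ c, proj (partialInnerB u ψ c)).trace := by
  change (opB (proj u) * vecMulVec ψ (star ψ)).trace = _
  rw [mul_vecMulVec, opB_proj_mulVec, trace_vecMulVec]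
  simp [dotProduct, partialInnerB, Fintype.sum_prod_type, Matrix.trace, proj]
  ring

lemma OrthonormalFamily.isUnitVec {ι n : Type*} [DecidableEq ι] [Fintype n] {u : ι → n → ℂ}
    (hu : OrthonormalFamily u) (i : ι) : IsUnitVec (u i) := by
  simpa [IsUnitVec] using hu i i

lemma orthonormalFamily_single {ι n : Type*} [DecidableEq ι] [Fintype n] [DecidableEq n]
    (e : ι ≃ n) : OrthonormalFamily fun i => (Pi.single (e i) 1 : n → ℂ) := by
  intro i j
  simp [Pi.single_apply, eq_comm]

/-- Measuring AB in a pure state leaves C in a pure state. -/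
lemma SCcondAB_proj_eq_zero {v : Fin 4 → Q4 → ℂ} (hv : OrthonormalFamily v) (ψ : Q3 → ℂ) :
    SCcondAB (proj ψ) v = 0 := by
  refine Finset.sum_eq_zero fun j _ => ?_
  split_ifs with hp
  · rw [vN_eq_zero_of_isIdempotentElem, mul_zero]
    have hpC : (pAB (proj ψ) v j : ℂ) =
        ∑ c, star (partialInnerAB (v j) ψ c) * partialInnerAB (v j) ψ c := by
      rw [pAB, trace_opAB_proj]
      simp [← Complex.normSq_eq_conj_mul_self]
    have hne : (pAB (proj ψ) v j : ℂ) ≠ 0 := by exact_mod_cast hp.ne'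
    rw [IsIdempotentElem, condC, rhoC_opAB_proj (hv.isUnitVec j), smul_mul_smul_comm,
      proj_mul_proj, ← hpC, smul_smul]
    congr 1
    field_simp
  · rfl

lemma condA_proj_isDensityMatrix {u : Fin 2 → Q2 → ℂ} (hu : OrthonormalFamily u) (ψ : Q3 → ℂ)
    {j : Fin 2} (hp : 0 < pB (proj ψ) u j) : IsDensityMatrix (condA (proj ψ) u j) := by
  have hpos : (∑ c, proj (partialInnerB (u j) ψ c)).PosSemidef :=
    posSemidef_sum _ fun c _ => proj_posSemidef _
  have hpC : (pB (proj ψ) u j : ℂ) = (∑ c, proj (partialInnerB (u j) ψ c)).trace := by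
    rw [pB, trace_opB_proj]
    exact Complex.conj_eq_iff_re.mp (by
      simpa [trace_conjTranspose] using congrArg Matrix.trace hpos.isHermitian.eq)
  have hne : (pB (proj ψ) u j : ℂ) ≠ 0 := by exact_mod_cast hp.ne'
  rw [IsDensityMatrix, condA, rhoA_opB_proj (hu.isUnitVec j)]
  refine ⟨hpos.smul ?_, ?_⟩
  · rw [← Complex.ofReal_inv]
    exact_mod_cast (inv_pos.mpr hp).le
  · rw [trace_smul, ← hpC, smul_eq_mul, inv_mul_cancel₀ hne]

lemma SAcondB_proj_nonneg {u : Fin 2 → Q2 → ℂ} (hu : OrthonormalFamily u) (ψ : Q3 → ℂ) :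
    0 ≤ SAcondB (proj ψ) u := by
  refine Finset.sum_nonneg fun j _ => ?_
  split_ifs with hp
  · exact mul_nonneg hp.le (vN_nonneg (condA_proj_isDensityMatrix hu ψ hp))
  · rfl

/-- For a pure three-qubit state `ρ = |ψ⟩⟨ψ|`, the residual correlation `δ_RC`
(the infimum of `D_RC` over all orthonormal measurement bases on B and on AB) equals
`S(ρ_B) + inf S(ρ_{A|Π^B})`, the latter infimum being over all orthonormal bases of ℂ². -/
theorem residual_correlation_min_pure_state
    (ψ : Q3 → ℂ) (hψ : IsUnitVec ψ) :
    sInf {x : ℝ | ∃ u : Fin 2 → Q2 → ℂ, ∃ v : Fin 4 → Q4 → ℂ,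
        OrthonormalFamily u ∧ OrthonormalFamily v ∧
        x = SCcondAB (proj ψ) v - vN (proj ψ) + vN (rhoB (proj ψ)) + SAcondB (proj ψ) u}
      = vN (rhoB (proj ψ)) +
        sInf {y : ℝ | ∃ u : Fin 2 → Q2 → ℂ, OrthonormalFamily u ∧ y = SAcondB (proj ψ) u} := by
  have hpure : vN (proj ψ) = 0 := by
    refine vN_eq_zero_of_isIdempotentElem ?_
    rw [IsIdempotentElem, proj_mul_proj, hψ, one_smul]
  have hu₀ : OrthonormalFamily fun i : Fin 2 => (Pi.single i 1 : Q2 → ℂ) :=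
    orthonormalFamily_single (Equiv.refl _)
  have hv₀ := orthonormalFamily_single (finProdFinEquiv (m := 2) (n := 2)).symm
  set S := {y : ℝ | ∃ u : Fin 2 → Q2 → ℂ, OrthonormalFamily u ∧ y = SAcondB (proj ψ) u}
  have hne : S.Nonempty := ⟨_, _, hu₀, rfl⟩
  have hbdd : BddBelow S := ⟨0, by rintro y ⟨u, hu, rfl⟩; exact SAcondB_proj_nonneg hu ψ⟩
  have himage : {x : ℝ | ∃ u : Fin 2 → Q2 → ℂ, ∃ v : Fin 4 → Q4 → ℂ,
      OrthonormalFamily u ∧ OrthonormalFamily v ∧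
      x = SCcondAB (proj ψ) v - vN (proj ψ) + vN (rhoB (proj ψ)) + SAcondB (proj ψ) u} =
      OrderIso.addLeft (vN (rhoB (proj ψ))) '' S := by
    ext x
    constructor
    · rintro ⟨u, v, hu, hv, rfl⟩
      exact ⟨_, ⟨u, hu, rfl⟩, by simp [SCcondAB_proj_eq_zero hv, hpure]⟩
    · rintro ⟨_, ⟨u, hu, rfl⟩, rfl⟩
      exact ⟨u, _, hu, hv₀, by simp [SCcondAB_proj_eq_zero hv₀, hpure]⟩
  rw [himage, ← OrderIso.map_csInf' _ hne hbdd]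
  rfl
end
end

section
/- Let ρ_ABD be a density matrix on ℂ^{d_A} ⊗ ℂ^{d_B} ⊗ ℂ^{d_D}. Then discarding the subsystem D cannot increase the mutual information: S(ρ_A) + S(ρ_B) − S(ρ_AB) ≤ S(ρ_A) + S(ρ_BD) − S(ρ_ABD); equivalently, S(ρ_BD) + S(ρ_AB) ≥ S(ρ_B) + S(ρ_ABD) (strong subadditivity of von Neumann entropy). -/
open scoped BigOperators ComplexOrder
open Matrix

noncomputable section

/-- Reduced state of A for a state on `A ⊗ B ⊗ D`. -/
def redA {dA dB dD : ℕ} (ρ : Matrix (Fin dA × Fin dB × Fin dD) (Fin dA × Fin dB × Fin dD) ℂ) :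
    Matrix (Fin dA) (Fin dA) ℂ := fun i i' => ∑ b, ∑ d, ρ (i, b, d) (i', b, d)

/-- Reduced state of B for a state on `A ⊗ B ⊗ D`. -/
def redB {dA dB dD : ℕ} (ρ : Matrix (Fin dA × Fin dB × Fin dD) (Fin dA × Fin dB × Fin dD) ℂ) :
    Matrix (Fin dB) (Fin dB) ℂ := fun b b' => ∑ a, ∑ d, ρ (a, b, d) (a, b', d)

/-- Reduced state of AB for a state on `A ⊗ B ⊗ D`. -/
def redAB {dA dB dD : ℕ} (ρ : Matrix (Fin dA × Fin dB × Fin dD) (Fin dA × Fin dB × Fin dD) ℂ) :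
    Matrix (Fin dA × Fin dB) (Fin dA × Fin dB) ℂ :=
  fun x y => ∑ d, ρ (x.1, x.2, d) (y.1, y.2, d)

/-- Reduced state of BD for a state on `A ⊗ B ⊗ D`. -/
def redBD {dA dB dD : ℕ} (ρ : Matrix (Fin dA × Fin dB × Fin dD) (Fin dA × Fin dB × Fin dD) ℂ) :
    Matrix (Fin dB × Fin dD) (Fin dB × Fin dD) ℂ :=
  fun x y => ∑ a, ρ (a, x.1, x.2) (a, y.1, y.2)

/-- The concave quadratic functional `X ↦ 2 Re tr(X*ρ) - tr(X*σX) - t tr(XρX*)`. -/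
def quadFunctional {n : Type*} [Fintype n] (ρ σ : Matrix n n ℂ) (t : ℝ) (X : Matrix n n ℂ) : ℝ :=
  2 * (Xᴴ * ρ).trace.re - (X * Xᴴ * σ).trace.re - t * (Xᴴ * X * ρ).trace.re

/-- The supremum of `quadFunctional` over `X`, in terms of spectral decompositions. -/
def quadSup {n : Type*} [Fintype n] (U V : Matrix n n ℂ) (p q : n → ℝ) (t : ℝ) : ℝ :=
  ∑ j, ∑ i, Complex.normSq ((Vᴴ * U) j i) * (p i ^ 2 / (q j + t * p i))

/-- The relative entropy of `U diag(p) U*` with respect to `V diag(q) V*`. -/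
def relEntropy {n : Type*} [Fintype n] (U V : Matrix n n ℂ) (p q : n → ℝ) : ℝ :=
  ∑ j, ∑ i, Complex.normSq ((Vᴴ * U) j i) * (p i * (Real.log (p i) - Real.log (q j)))

/-- The integral of `quadSup` over `[0, T]`. -/
def quadSupIntegral {n : Type*} [Fintype n] (U V : Matrix n n ℂ) (p q : n → ℝ) (T : ℝ) : ℝ :=
  ∑ j, ∑ i, Complex.normSq ((Vᴴ * U) j i) *
    (p i * (Real.log (q j + T * p i) - Real.log (q j)))

lemma hasDerivAt_quadSupIntegral {n : Type*} [Fintype n] (U V : Matrix n n ℂ)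
    {p q : n → ℝ} (hp : ∀ i, 0 ≤ p i) (hq : ∀ j, 0 < q j) {T : ℝ} (hT : 0 ≤ T) :
    HasDerivAt (quadSupIntegral U V p q) (quadSup U V p q T) T := by
  unfold quadSupIntegral quadSup
  refine HasDerivAt.fun_sum fun j _ => HasDerivAt.fun_sum fun i _ => HasDerivAt.const_mul _ ?_
  have hs : q j + T * p i ≠ 0 := (add_pos_of_pos_of_nonneg (hq j) (mul_nonneg hT (hp i))).ne'
  have h := ((((hasDerivAt_id T).mul_const (p i)).const_add (q j)).log hs).sub_const
    (Real.log (q j)) |>.const_mul (p i)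
  rwa [one_mul, ← mul_div_assoc, ← sq] at h

lemma quadSupIntegral_zero {n : Type*} [Fintype n] (U V : Matrix n n ℂ) (p q : n → ℝ) :
    quadSupIntegral U V p q 0 = 0 := by simp [quadSupIntegral]

section Spectral

variable {n : Type*} [Fintype n] [DecidableEq n]

/-- `U` diagonalizes `ρ` with spectrum `p`. -/
def Diagonalizes (U : Matrix n n ℂ) (p : n → ℝ) (ρ : Matrix n n ℂ) : Prop :=
  U ∈ unitaryGroup n ℂ ∧ ρ = U * diagonal (fun i => (p i : ℂ)) * Uᴴ

lemma Diagonalizes.conjTranspose_mul_self {U : Matrix n n ℂ} {p : n → ℝ} {ρ : Matrix n n ℂ}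
    (h : Diagonalizes U p ρ) : Uᴴ * U = 1 := mem_unitaryGroup_iff'.1 h.1

lemma Diagonalizes.mul_conjTranspose_self {U : Matrix n n ℂ} {p : n → ℝ} {ρ : Matrix n n ℂ}
    (h : Diagonalizes U p ρ) : U * Uᴴ = 1 := mem_unitaryGroup_iff.1 h.1

lemma diagonalizes_eigenvectorUnitary {ρ : Matrix n n ℂ} (h : ρ.IsHermitian) :
    Diagonalizes (h.eigenvectorUnitary : Matrix n n ℂ) h.eigenvalues ρ :=
  ⟨h.eigenvectorUnitary.2, h.spectral_theorem⟩

lemma quadFunctional_eq_sum {U V ρ σ : Matrix n n ℂ} {p q : n → ℝ}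
    (hρ : Diagonalizes U p ρ) (hσ : Diagonalizes V q σ) (t : ℝ) (Y : Matrix n n ℂ) :
    quadFunctional ρ σ t (V * Y * Uᴴ) =
      ∑ j, ∑ i, (2 * (p i * (star (Y j i) * (Vᴴ * U) j i).re)
        - (q j + t * p i) * Complex.normSq (Y j i)) := by
  have hU := hρ.conjTranspose_mul_self
  have hV := hσ.conjTranspose_mul_self
  have cU (Z : Matrix n n ℂ) : Uᴴ * (U * Z) = Z := by rw [← Matrix.mul_assoc, hU, Matrix.one_mul]
  have cV (Z : Matrix n n ℂ) : Vᴴ * (V * Z) = Z := by rw [← Matrix.mul_assoc, hV, Matrix.one_mul]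
  have h₁ : ((V * Y * Uᴴ)ᴴ * ρ).trace
      = ((Yᴴ * (Vᴴ * U)) * diagonal (fun i => (p i : ℂ))).trace := by
    rw [hρ.2, conjTranspose_mul, conjTranspose_mul, conjTranspose_conjTranspose]
    rw [show U * (Yᴴ * Vᴴ) * (U * diagonal (fun i => (p i : ℂ)) * Uᴴ)
      = U * ((Yᴴ * (Vᴴ * U)) * diagonal (fun i => (p i : ℂ)) * Uᴴ) by
        simp only [Matrix.mul_assoc], trace_mul_comm]
    simp only [Matrix.mul_assoc, hU, Matrix.mul_one]
  have h₂ : ((V * Y * Uᴴ) * (V * Y * Uᴴ)ᴴ * σ).trace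
      = ((Y * Yᴴ) * diagonal (fun i => (q i : ℂ))).trace := by
    rw [hσ.2]
    simp only [conjTranspose_mul, conjTranspose_conjTranspose, Matrix.mul_assoc, cU, cV]
    rw [trace_mul_comm]
    simp only [Matrix.mul_assoc, hV, Matrix.mul_one]
  have h₃ : ((V * Y * Uᴴ)ᴴ * (V * Y * Uᴴ) * ρ).trace
      = ((Yᴴ * Y) * diagonal (fun i => (p i : ℂ))).trace := by
    rw [hρ.2]
    simp only [conjTranspose_mul, conjTranspose_conjTranspose, Matrix.mul_assoc, cU, cV]
    rw [trace_mul_comm]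
    simp only [Matrix.mul_assoc, hU, Matrix.mul_one]
  rw [quadFunctional, h₁, h₂, h₃]
  simp only [trace, diag_apply, mul_diagonal, mul_apply (M := Yᴴ), mul_apply (M := Y),
    conjTranspose_apply, Complex.re_sum, Finset.sum_mul, Finset.mul_sum, Finset.sum_sub_distrib]
  rw [Finset.sum_comm, sub_sub]
  congr 1
  · refine Finset.sum_congr rfl fun j _ => Finset.sum_congr rfl fun i _ => ?_
    rw [Complex.re_mul_ofReal]; ring
  · rw [Finset.sum_comm (f := fun i j => t * (star (Y j i) * Y j i * (p i : ℂ)).re),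
      ← Finset.sum_add_distrib]
    refine Finset.sum_congr rfl fun j _ => ?_
    rw [← Finset.sum_add_distrib]
    refine Finset.sum_congr rfl fun i _ => ?_
    simp only [Complex.normSq_apply, Complex.star_def, Complex.mul_re, Complex.mul_im,
      Complex.conj_re, Complex.conj_im, Complex.ofReal_re, Complex.ofReal_im]
    ring

lemma quadratic_le_of_pos {s : ℝ} (hs : 0 < s) (p : ℝ) (y w : ℂ) :
    2 * (p * (star y * w).re) - s * Complex.normSq y ≤ Complex.normSq w * (p ^ 2 / s) := by
  rw [← mul_div_assoc, le_div_iff₀ hs]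
  simp only [Complex.normSq_apply, Complex.star_def, Complex.mul_re,
      Complex.conj_re, Complex.conj_im]
  nlinarith [sq_nonneg (s * y.re - p * w.re), sq_nonneg (s * y.im - p * w.im)]

lemma quadFunctional_le_quadSup {U V ρ σ : Matrix n n ℂ} {p q : n → ℝ}
    (hρ : Diagonalizes U p ρ) (hσ : Diagonalizes V q σ) {t : ℝ} (ht : 0 ≤ t)
    (hp : ∀ i, 0 ≤ p i) (hq : ∀ j, 0 < q j) (X : Matrix n n ℂ) :
    quadFunctional ρ σ t X ≤ quadSup U V p q t := by
  have hX : X = V * (Vᴴ * X * U) * Uᴴ := by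
    simp only [Matrix.mul_assoc, hρ.mul_conjTranspose_self, Matrix.mul_one]
    rw [← Matrix.mul_assoc, hσ.mul_conjTranspose_self, Matrix.one_mul]
  rw [hX, quadFunctional_eq_sum hρ hσ]
  refine Finset.sum_le_sum fun j _ => Finset.sum_le_sum fun i _ => ?_
  exact quadratic_le_of_pos (add_pos_of_pos_of_nonneg (hq j) (mul_nonneg ht (hp i))) _ _ _

lemma exists_quadFunctional_eq_quadSup {U V ρ σ : Matrix n n ℂ} {p q : n → ℝ}
    (hρ : Diagonalizes U p ρ) (hσ : Diagonalizes V q σ) {t : ℝ} (ht : 0 ≤ t)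
    (hp : ∀ i, 0 ≤ p i) (hq : ∀ j, 0 < q j) :
    ∃ X, quadFunctional ρ σ t X = quadSup U V p q t := by
  refine ⟨V * (of fun j i => ((p i / (q j + t * p i) : ℝ) : ℂ) * (Vᴴ * U) j i) * Uᴴ, ?_⟩
  rw [quadFunctional_eq_sum hρ hσ]
  refine Finset.sum_congr rfl fun j _ => Finset.sum_congr rfl fun i _ => ?_
  have hs : q j + t * p i ≠ 0 := (add_pos_of_pos_of_nonneg (hq j) (mul_nonneg ht (hp i))).ne'
  rw [of_apply]
  generalize q j + t * p i = s at hs ⊢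
  simp only [Complex.normSq_apply, Complex.star_def, Complex.mul_re, Complex.mul_im,
    Complex.conj_re, Complex.conj_im, Complex.ofReal_re, Complex.ofReal_im]
  field_simp
  ring

lemma sum_normSq_col {U V ρ σ : Matrix n n ℂ} {p q : n → ℝ}
    (hρ : Diagonalizes U p ρ) (hσ : Diagonalizes V q σ) (i : n) :
    ∑ j, Complex.normSq ((Vᴴ * U) j i) = 1 := by
  have h : (Vᴴ * U)ᴴ * (Vᴴ * U) = 1 := by
    rw [conjTranspose_mul, conjTranspose_conjTranspose, Matrix.mul_assoc, ← Matrix.mul_assoc V,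
      hσ.mul_conjTranspose_self, Matrix.one_mul, hρ.conjTranspose_mul_self]
  have := congrFun (congrFun h i) i
  rw [mul_apply, one_apply_eq] at this
  have := congrArg Complex.re this
  simpa [Complex.normSq_apply] using this

lemma sum_normSq_row_mul {U ρ : Matrix n n ℂ} {p : n → ℝ} (hρ : Diagonalizes U p ρ)
    (V : Matrix n n ℂ) (j : n) :
    ∑ i, Complex.normSq ((Vᴴ * U) j i) * p i = ((Vᴴ * ρ * V) j j).re := by
  have h : Vᴴ * ρ * V = (Vᴴ * U) * diagonal (fun i => (p i : ℂ)) * (Vᴴ * U)ᴴ := by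
    rw [hρ.2, conjTranspose_mul, conjTranspose_conjTranspose]
    simp only [Matrix.mul_assoc]
  rw [h, mul_apply, Complex.re_sum]
  refine Finset.sum_congr rfl fun i _ => ?_
  simp only [mul_diagonal, conjTranspose_apply, Complex.star_def, Complex.normSq_apply,
    Complex.mul_re, Complex.mul_im, Complex.conj_re, Complex.conj_im, Complex.ofReal_re,
    Complex.ofReal_im]
  ring

lemma Diagonalizes.sum_eq_trace {U ρ : Matrix n n ℂ} {p : n → ℝ} (hρ : Diagonalizes U p ρ) :
    ∑ i, p i = ρ.trace.re := by
  rw [hρ.2, trace_mul_comm, ← Matrix.mul_assoc, hρ.conjTranspose_mul_self, Matrix.one_mul,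
    trace_diagonal]
  simp

lemma relEntropy_eq {U V ρ σ : Matrix n n ℂ} {p q : n → ℝ}
    (hρ : Diagonalizes U p ρ) (hσ : Diagonalizes V q σ) :
    relEntropy U V p q =
      -∑ i, Real.negMulLog (p i) - ∑ j, ((Vᴴ * ρ * V) j j).re * Real.log (q j) := by
  simp only [relEntropy, mul_sub, Finset.sum_sub_distrib]
  congr 1
  · rw [Finset.sum_comm, ← Finset.sum_neg_distrib]
    refine Finset.sum_congr rfl fun i _ => ?_
    rw [← Finset.sum_mul, sum_normSq_col hρ hσ, Real.negMulLog]
    ring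
  · refine Finset.sum_congr rfl fun j _ => ?_
    rw [← sum_normSq_row_mul hρ, Finset.sum_mul]
    refine Finset.sum_congr rfl fun i _ => ?_
    ring

open Filter Topology in
lemma tendsto_quadSupIntegral {U V ρ σ : Matrix n n ℂ} {p q : n → ℝ}
    (hρ : Diagonalizes U p ρ) (hσ : Diagonalizes V q σ) (hp : ∀ i, 0 ≤ p i) (hq : ∀ j, 0 < q j) :
    Tendsto (fun T => quadSupIntegral U V p q T - ρ.trace.re * Real.log T) atTop
      (𝓝 (relEntropy U V p q)) := by
  have h : ∀ T, quadSupIntegral U V p q T - ρ.trace.re * Real.log T =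
      ∑ j, ∑ i, Complex.normSq ((Vᴴ * U) j i) *
        (p i * (Real.log (q j + T * p i) - Real.log T - Real.log (q j))) := by
    intro T
    have : ρ.trace.re * Real.log T =
        ∑ j, ∑ i, Complex.normSq ((Vᴴ * U) j i) * (p i * Real.log T) := by
      rw [← hρ.sum_eq_trace, Finset.sum_comm, Finset.sum_mul]
      refine Finset.sum_congr rfl fun i _ => ?_
      rw [← Finset.sum_mul, sum_normSq_col hρ hσ, one_mul]
    rw [this, quadSupIntegral]
    simp only [← Finset.sum_sub_distrib]
    refine Finset.sum_congr rfl fun j _ => Finset.sum_congr rfl fun i _ => ?_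
    ring
  simp only [h, relEntropy]
  refine tendsto_finsetSum _ fun j _ => tendsto_finsetSum _ fun i _ => Tendsto.const_mul _ ?_
  rcases (hp i).eq_or_lt with h0 | h0
  · simp [← h0]
  refine Tendsto.const_mul _ (Tendsto.sub_const ?_ _)
  have hlim : Tendsto (fun T : ℝ => q j / T + p i) atTop (𝓝 (p i)) := by
    simpa using (tendsto_const_nhds.div_atTop tendsto_id).add_const (p i)
  refine (hlim.log h0.ne').congr' ?_
  filter_upwards [eventually_gt_atTop 0] with T hT
  rw [← Real.log_div (by have := hq j; positivity) hT.ne']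
  congr 1
  field_simp

end Spectral

/-- Monotonicity of relative entropy under a map dual to `Φ`. -/
lemma relEntropy_le_of_quadFunctional_eq {n m : Type*} [Fintype n] [DecidableEq n]
    [Fintype m] [DecidableEq m] {U V ρ σ : Matrix n n ℂ} {p q : n → ℝ}
    {U' V' ρ' σ' : Matrix m m ℂ} {p' q' : m → ℝ}
    (hρ : Diagonalizes U p ρ) (hσ : Diagonalizes V q σ) (hp : ∀ i, 0 ≤ p i) (hq : ∀ j, 0 < q j)
    (hρ' : Diagonalizes U' p' ρ') (hσ' : Diagonalizes V' q' σ') (hp' : ∀ i, 0 ≤ p' i)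
    (hq' : ∀ j, 0 < q' j) (htr : ρ'.trace = ρ.trace)
    (Φ : Matrix m m ℂ → Matrix n n ℂ)
    (hΦ : ∀ t X, quadFunctional ρ σ t (Φ X) = quadFunctional ρ' σ' t X) :
    relEntropy U' V' p' q' ≤ relEntropy U V p q := by
  have hsup : ∀ t, 0 ≤ t → quadSup U' V' p' q' t ≤ quadSup U V p q t := by
    intro t ht
    obtain ⟨X, hX⟩ := exists_quadFunctional_eq_quadSup hρ' hσ' ht hp' hq'
    rw [← hX, ← hΦ]
    exact quadFunctional_le_quadSup hρ hσ ht hp hq _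
  have hderiv : ∀ T, 0 ≤ T → HasDerivAt
      (fun T => quadSupIntegral U V p q T - quadSupIntegral U' V' p' q' T)
      (quadSup U V p q T - quadSup U' V' p' q' T) T := fun T hT =>
    (hasDerivAt_quadSupIntegral U V hp hq hT).fun_sub
      (hasDerivAt_quadSupIntegral U' V' hp' hq' hT)
  have hmono : MonotoneOn
      (fun T => quadSupIntegral U V p q T - quadSupIntegral U' V' p' q' T) (Set.Ici 0) := by
    refine monotoneOn_of_deriv_nonneg (convex_Ici 0)
      (fun T hT => (hderiv T hT).continuousAt.continuousWithinAt)
      (fun T hT => (hderiv T (interior_subset hT)).differentiableAt.differentiableWithinAt)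
      fun T hT => ?_
    rw [(hderiv T (interior_subset hT)).deriv]
    exact sub_nonneg.2 (hsup T (interior_subset hT))
  refine le_of_tendsto_of_tendsto (tendsto_quadSupIntegral hρ' hσ' hp' hq')
    (tendsto_quadSupIntegral hρ hσ hp hq) ?_
  filter_upwards [Filter.eventually_ge_atTop 0] with T hT
  have h := hmono Set.self_mem_Ici hT hT
  simp only [quadSupIntegral_zero, sub_zero] at h
  rw [htr]
  linarith

open scoped Kronecker

/-- The partial trace over the left tensor factor. -/
def traceLeft {m n : Type*} [Fintype m] (ρ : Matrix (m × n) (m × n) ℂ) : Matrix n n ℂ :=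
  fun x y => ∑ a, ρ (a, x) (a, y)

lemma sum_conj_one_kronecker_apply {m n : Type*} [Fintype m] [DecidableEq m] [Fintype n]
    (ρ : Matrix (m × n) (m × n) ℂ) (V : Matrix n n ℂ) (k : n) :
    ∑ a, (((1 : Matrix m m ℂ) ⊗ₖ V)ᴴ * ρ * ((1 : Matrix m m ℂ) ⊗ₖ V)) (a, k) (a, k) =
      (Vᴴ * traceLeft ρ * V) k k := by
  simp only [mul_apply, Fintype.sum_prod_type, conjTranspose_apply, kroneckerMap_apply, one_apply,
    traceLeft, ite_mul, one_mul, zero_mul, mul_ite, mul_zero, apply_ite star, star_zero,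
    Finset.sum_ite_irrel, Finset.sum_const_zero, Finset.sum_ite_eq',
    Finset.mem_univ, if_true, Finset.sum_mul, Finset.mul_sum]
  rw [Finset.sum_comm]
  refine Finset.sum_congr rfl fun x _ => ?_
  rw [Finset.sum_comm]

section PartialTrace

variable {m n : Type*} [Fintype m] [DecidableEq m] [Fintype n] [DecidableEq n]

lemma Diagonalizes.one_kronecker_add_smul {V τ : Matrix n n ℂ} {q : n → ℝ}
    (h : Diagonalizes V q τ) (δ : ℝ) :
    Diagonalizes ((1 : Matrix m m ℂ) ⊗ₖ V) (fun x => q x.2 + δ)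
      ((1 : Matrix m m ℂ) ⊗ₖ τ + (δ : ℂ) • 1) := by
  have hV : ((1 : Matrix m m ℂ) ⊗ₖ V) * ((1 : Matrix m m ℂ) ⊗ₖ V)ᴴ = 1 := by
    rw [conjTranspose_kronecker, ← mul_kronecker_mul, h.mul_conjTranspose_self,
      conjTranspose_one, Matrix.one_mul, one_kronecker_one]
  refine ⟨mem_unitaryGroup_iff.2 hV, ?_⟩
  have hd : diagonal (fun x : m × n => ((q x.2 + δ : ℝ) : ℂ)) =
      (1 : Matrix m m ℂ) ⊗ₖ diagonal (fun i => (q i : ℂ)) + (δ : ℂ) • 1 := by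
    ext ⟨a, k⟩ ⟨b, l⟩
    by_cases hab : a = b <;> by_cases hkl : k = l <;>
      simp [hab, hkl, one_apply, kroneckerMap_apply]
  rw [hd, Matrix.mul_add, Matrix.add_mul, Matrix.mul_smul, Matrix.smul_mul, Matrix.mul_one, hV,
    conjTranspose_kronecker, ← mul_kronecker_mul, ← mul_kronecker_mul, ← h.2,
    conjTranspose_one, Matrix.one_mul, Matrix.one_mul]

lemma relEntropy_one_kronecker {U ρ : Matrix (m × n) (m × n) ℂ} {p : m × n → ℝ}
    {V : Matrix n n ℂ} {q : n → ℝ} (hρ : Diagonalizes U p ρ)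
    (hV : Diagonalizes V q (traceLeft ρ)) (δ : ℝ) :
    relEntropy U ((1 : Matrix m m ℂ) ⊗ₖ V) p (fun x => q x.2 + δ) =
      -∑ i, Real.negMulLog (p i) - ∑ k, q k * Real.log (q k + δ) := by
  rw [relEntropy_eq hρ (hV.one_kronecker_add_smul δ)]
  congr 1
  rw [Fintype.sum_prod_type_right]
  refine Finset.sum_congr rfl fun k _ => ?_
  dsimp only
  rw [← Finset.sum_mul, ← Complex.re_sum, sum_conj_one_kronecker_apply]
  congr 1
  rw [hV.2]
  have h : Vᴴ * (V * diagonal (fun i => (q i : ℂ)) * Vᴴ) * V = diagonal (fun i => (q i : ℂ)) := by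
    rw [Matrix.mul_assoc, Matrix.mul_assoc, Matrix.mul_assoc, hV.conjTranspose_mul_self,
      Matrix.mul_one, ← Matrix.mul_assoc, hV.conjTranspose_mul_self, Matrix.one_mul]
  rw [h, diagonal_apply_eq, Complex.ofReal_re]

end PartialTrace

open Filter Topology in
lemma tendsto_sum_mul_log_add {n : Type*} [Fintype n] (q : n → ℝ) (c : ℝ) :
    Tendsto (fun δ => ∑ k, q k * Real.log (q k + c * δ)) (𝓝[>] 0)
      (𝓝 (-∑ k, Real.negMulLog (q k))) := by
  rw [← Finset.sum_neg_distrib]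
  refine tendsto_finsetSum _ fun k _ => ?_
  rcases eq_or_ne (q k) 0 with h | h
  · simp [h]
  rw [Real.negMulLog, neg_mul, neg_neg]
  refine Tendsto.const_mul _ (Tendsto.log ?_ h)
  have : Continuous fun δ : ℝ => q k + c * δ := by fun_prop
  simpa using this.continuousWithinAt (s := Set.Ioi 0) (x := 0) |>.tendsto

lemma vN_eq {n : Type*} [Fintype n] [DecidableEq n] {ρ : Matrix n n ℂ} (h : ρ.IsHermitian) :
    vN ρ = ∑ i, Real.negMulLog (h.eigenvalues i) := dif_pos h

section Tripartite

variable {dA dB dD : ℕ}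

/-- The embedding `X ↦ X ⊗ 1` of operators on `A ⊗ B` into operators on `A ⊗ B ⊗ D`. -/
def tensorOneD (dD : ℕ) (X : Matrix (Fin dA × Fin dB) (Fin dA × Fin dB) ℂ) :
    Matrix (Fin dA × Fin dB × Fin dD) (Fin dA × Fin dB × Fin dD) ℂ :=
  (X ⊗ₖ (1 : Matrix (Fin dD) (Fin dD) ℂ)).submatrix (Equiv.prodAssoc _ _ _).symm
    (Equiv.prodAssoc _ _ _).symm

lemma conjTranspose_tensorOneD (X : Matrix (Fin dA × Fin dB) (Fin dA × Fin dB) ℂ) :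
    (tensorOneD dD X)ᴴ = tensorOneD dD Xᴴ := by
  rw [tensorOneD, conjTranspose_submatrix, conjTranspose_kronecker, conjTranspose_one, tensorOneD]

lemma tensorOneD_mul (X Y : Matrix (Fin dA × Fin dB) (Fin dA × Fin dB) ℂ) :
    tensorOneD dD X * tensorOneD dD Y = tensorOneD dD (X * Y) := by
  rw [tensorOneD, tensorOneD, submatrix_mul_equiv, ← mul_kronecker_mul, Matrix.one_mul, tensorOneD]

lemma trace_tensorOneD_mul (X : Matrix (Fin dA × Fin dB) (Fin dA × Fin dB) ℂ)
    (ρ : Matrix (Fin dA × Fin dB × Fin dD) (Fin dA × Fin dB × Fin dD) ℂ) :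
    (tensorOneD dD X * ρ).trace = (X * redAB ρ).trace := by
  simp only [trace, diag_apply, mul_apply, Fintype.sum_prod_type, tensorOneD, submatrix_apply,
    kroneckerMap_apply, one_apply, redAB, Equiv.prodAssoc_symm_apply, mul_ite, mul_one, mul_zero,
    ite_mul, zero_mul, Finset.sum_ite_eq, Finset.mem_univ, if_true, Finset.mul_sum]
  refine Finset.sum_congr rfl fun a _ => Finset.sum_congr rfl fun b _ => ?_
  rw [Finset.sum_comm]
  refine Finset.sum_congr rfl fun a' _ => ?_
  rw [Finset.sum_comm]

lemma quadFunctional_tensorOneD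
    (ρ σ : Matrix (Fin dA × Fin dB × Fin dD) (Fin dA × Fin dB × Fin dD) ℂ) (t : ℝ)
    (X : Matrix (Fin dA × Fin dB) (Fin dA × Fin dB) ℂ) :
    quadFunctional ρ σ t (tensorOneD dD X) = quadFunctional (redAB ρ) (redAB σ) t X := by
  simp only [quadFunctional, conjTranspose_tensorOneD, tensorOneD_mul, trace_tensorOneD_mul]

lemma trace_redAB (ρ : Matrix (Fin dA × Fin dB × Fin dD) (Fin dA × Fin dB × Fin dD) ℂ) :
    (redAB ρ).trace = ρ.trace := by
  simp only [trace, diag_apply, redAB, Fintype.sum_prod_type]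

lemma redAB_one_kronecker_redBD_add_smul
    (ρ : Matrix (Fin dA × Fin dB × Fin dD) (Fin dA × Fin dB × Fin dD) ℂ) (δ : ℝ) :
    redAB ((1 : Matrix (Fin dA) (Fin dA) ℂ) ⊗ₖ redBD ρ + (δ : ℂ) • 1) =
      (1 : Matrix (Fin dA) (Fin dA) ℂ) ⊗ₖ redB ρ + ((dD * δ : ℝ) : ℂ) • 1 := by
  ext ⟨a, b⟩ ⟨a', b'⟩
  simp only [redAB, redBD, redB, Matrix.add_apply, kroneckerMap_apply, Matrix.smul_apply,
    Finset.sum_add_distrib, smul_eq_mul]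
  congr 1
  · rw [Finset.sum_comm, Finset.mul_sum]
  · by_cases ha : a = a' <;> by_cases hb : b = b' <;> simp [ha, hb, one_apply]

lemma posSemidef_redAB {ρ : Matrix (Fin dA × Fin dB × Fin dD) (Fin dA × Fin dB × Fin dD) ℂ}
    (hρ : ρ.PosSemidef) : (redAB ρ).PosSemidef := by
  have h : redAB ρ = ∑ d, ρ.submatrix (fun x => (x.1, x.2, d)) (fun x => (x.1, x.2, d)) := by
    ext x y
    simp [redAB, Matrix.sum_apply]
  rw [h]
  exact posSemidef_sum _ fun d _ => hρ.submatrix _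

lemma posSemidef_traceLeft {m n : Type*} [Fintype m] {ρ : Matrix (m × n) (m × n) ℂ}
    (hρ : ρ.PosSemidef) : (traceLeft ρ).PosSemidef := by
  have h : traceLeft ρ = ∑ a, ρ.submatrix (fun x => (a, x)) (fun x => (a, x)) := by
    ext x y
    simp [traceLeft, Matrix.sum_apply]
  rw [h]
  exact posSemidef_sum _ fun d _ => hρ.submatrix _

open Filter Topology in
/-- Strong subadditivity of the von Neumann entropy. -/
lemma vN_strong_subadditivity
    {ρ : Matrix (Fin dA × Fin dB × Fin dD) (Fin dA × Fin dB × Fin dD) ℂ}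
    (hρ : ρ.PosSemidef) (hD : 0 < dD) :
    vN (redB ρ) + vN ρ ≤ vN (redBD ρ) + vN (redAB ρ) := by
  have hAB := posSemidef_redAB hρ
  have hB : (redB ρ).PosSemidef := posSemidef_traceLeft hAB
  have hBD : (redBD ρ).PosSemidef := posSemidef_traceLeft hρ
  have hD' : (0 : ℝ) < dD := Nat.cast_pos.2 hD
  have key : ∀ δ : ℝ, 0 < δ →
      -vN (redAB ρ) - ∑ k, hB.1.eigenvalues k * Real.log (hB.1.eigenvalues k + dD * δ) ≤
      -vN ρ - ∑ k, hBD.1.eigenvalues k * Real.log (hBD.1.eigenvalues k + 1 * δ) := by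
    intro δ hδ
    have dB := diagonalizes_eigenvectorUnitary hB.1
    have dBD := diagonalizes_eigenvectorUnitary hBD.1
    have dAB := diagonalizes_eigenvectorUnitary hAB.1
    have dρ := diagonalizes_eigenvectorUnitary hρ.1
    rw [vN_eq hAB.1, vN_eq hρ.1, one_mul, ← relEntropy_one_kronecker dAB dB,
      ← relEntropy_one_kronecker dρ dBD]
    refine relEntropy_le_of_quadFunctional_eq dρ (dBD.one_kronecker_add_smul δ)
      hρ.eigenvalues_nonneg (fun j => add_pos_of_nonneg_of_pos (hBD.eigenvalues_nonneg _) hδ) dAB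
      (dB.one_kronecker_add_smul _) hAB.eigenvalues_nonneg
      (fun j => add_pos_of_nonneg_of_pos (hB.eigenvalues_nonneg _) (mul_pos hD' hδ))
      (trace_redAB ρ) (tensorOneD dD) fun t X => ?_
    rw [quadFunctional_tensorOneD, redAB_one_kronecker_redBD_add_smul]
  have hlim := le_of_tendsto_of_tendsto
    ((tendsto_sum_mul_log_add hB.1.eigenvalues dD).const_sub (-vN (redAB ρ)))
    ((tendsto_sum_mul_log_add hBD.1.eigenvalues 1).const_sub (-vN ρ))
    (eventually_nhdsWithin_of_forall key)
  rw [← vN_eq, ← vN_eq] at hlim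
  linarith

end Tripartite

/-- Discarding subsystem D cannot increase the mutual information:
`S(ρ_A) + S(ρ_B) − S(ρ_AB) ≤ S(ρ_A) + S(ρ_BD) − S(ρ_ABD)`; equivalently
`S(ρ_BD) + S(ρ_AB) ≥ S(ρ_B) + S(ρ_ABD)` (strong subadditivity). -/
theorem discarding_subsystem_cannot_increase_mutual_information {dA dB dD : ℕ}
    (ρ : Matrix (Fin dA × Fin dB × Fin dD) (Fin dA × Fin dB × Fin dD) ℂ)
    (hρ : IsDensityMatrix ρ) :
    (vN (redA ρ) + vN (redB ρ) - vN (redAB ρ)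
      ≤ vN (redA ρ) + vN (redBD ρ) - vN ρ) ∧
    (vN (redB ρ) + vN ρ ≤ vN (redBD ρ) + vN (redAB ρ)) := by
  have hD : 0 < dD := by
    rcases Nat.eq_zero_or_pos dD with rfl | h
    · have := hρ.2
      simp [trace] at this
    · exact h
  have h := vN_strong_subadditivity hρ.1 hD
  exact ⟨by linarith, h⟩
end
end

section
/- Let ρ_ABC be a three-qubit density matrix and fix an orthonormal basis {|u₁⟩,|u₂⟩} of ℂ² defining a rank-one projective measurement on subsystem B. Then measuring B cannot decrease the conditional entropy of AC given B: ∑_{j: pⱼ>0} pⱼ S(ρ_{AC|j}) ≥ S(ρ_ABC) − S(ρ_B), where pⱼ = Tr((I⊗πⱼ⊗I) ρ_ABC) and ρ_{AC|j} is the conditional post-measurement state of AC given outcome j. -/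
open scoped BigOperators ComplexOrder
open Matrix

noncomputable section

/-- Conditional state of AC given outcome `j` of the measurement on B. -/
def condAC (ρ : Matrix Q3 Q3 ℂ) (u : Fin 2 → Q2 → ℂ) (j : Fin 2) : Matrix Q4 Q4 ℂ :=
  ((pB ρ u j : ℂ))⁻¹ • rhoAC (opB (proj (u j)) * ρ * opB (proj (u j)))

open Filter Topology

/-- Pointwise comparison of resolvent sums integrates to a comparison of logarithmic sums. -/
theorem sum_mul_log_le_of_resolvent_le {κ ι : Type*} [Fintype κ] [Fintype ι]
    (g l : κ → ℝ) (w a b : ι → ℝ)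
    (hl : ∀ k, 0 ≤ l k) (ha : ∀ i, 0 ≤ a i) (hb : ∀ i, 0 ≤ b i)
    (hsum : ∑ k, g k * l k = ∑ i, w i * a i) (hsupp : ∀ i, b i = 0 → w i * a i = 0)
    (h : ∀ t : ℝ, 0 < t →
      ∑ k, g k * l k * (l k / (1 + t * l k)) ≤ ∑ i, w i * a i * (a i / (b i + t * a i))) :
    ∑ k, g k * l k * Real.log (l k) ≤ ∑ i, w i * a i * (Real.log (a i) - Real.log (b i)) := by
  set F : ℝ → ℝ := fun t => ∑ k, g k * l k * Real.log (1 + t * l k) with hF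
  set G : ℝ → ℝ := fun t => ∑ i, w i * a i * (Real.log (b i + t * a i) - Real.log (b i)) with hG
  have hFd : ∀ t : ℝ, 0 ≤ t → HasDerivAt F (∑ k, g k * l k * (l k / (1 + t * l k))) t := by
    intro t ht
    refine HasDerivAt.fun_sum fun k _ => HasDerivAt.const_mul _ ?_
    have hpos : 1 + t * l k ≠ 0 := by have := mul_nonneg ht (hl k); positivity
    have := (((hasDerivAt_id t).mul_const (l k)).const_add 1).log hpos
    simpa using this
  have hGd : ∀ t : ℝ, 0 ≤ t → HasDerivAt G (∑ i, w i * a i * (a i / (b i + t * a i))) t := by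
    intro t ht
    refine HasDerivAt.fun_sum fun i _ => ?_
    by_cases h0 : w i * a i = 0
    · simpa [h0] using hasDerivAt_const t (0 : ℝ)
    refine HasDerivAt.const_mul _ ?_
    have hbi : 0 < b i := lt_of_le_of_ne (hb i) fun hz => h0 (hsupp i hz.symm)
    have hpos : b i + t * a i ≠ 0 := by have := mul_nonneg ht (ha i); positivity
    have := ((((hasDerivAt_id t).mul_const (a i)).const_add (b i)).log hpos).sub_const
      (Real.log (b i))
    simpa using this
  have hmono : MonotoneOn (fun t => G t - F t) (Set.Ici 0) := by
    refine monotoneOn_of_deriv_nonneg (convex_Ici 0) ?_ ?_ ?_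
    · exact fun t ht => ((hGd t ht).sub (hFd t ht)).continuousAt.continuousWithinAt
    · intro t ht
      rw [interior_Ici] at ht
      exact ((hGd t ht.le).sub (hFd t ht.le)).differentiableAt.differentiableWithinAt
    · intro t ht
      rw [interior_Ici] at ht
      have := ((hGd t ht.le).sub (hFd t ht.le)).deriv
      rw [show (fun t => G t - F t) = G - F from rfl, this]
      exact sub_nonneg.2 (h t ht)
  have hle : ∀ t : ℝ, 0 < t → F t ≤ G t := by
    intro t ht
    have := hmono (Set.mem_Ici.2 le_rfl) (Set.mem_Ici.2 ht.le) ht.le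
    simp only [hF, hG] at this ⊢
    simpa using this
  have key : ∀ c x : ℝ, 0 < x →
      Tendsto (fun t : ℝ => Real.log (c + t * x) - Real.log t) atTop (𝓝 (Real.log x)) := by
    intro c x hx
    have h1 : Tendsto (fun t : ℝ => c / t + x) atTop (𝓝 (0 + x)) :=
      (tendsto_const_nhds.div_atTop tendsto_id).add_const x
    rw [zero_add] at h1
    refine (h1.log hx.ne').congr' ?_
    have hev : ∀ᶠ t : ℝ in atTop, 0 < c + t * x :=
      (tendsto_atTop_add_const_left _ c (tendsto_id.atTop_mul_const hx)).eventually_gt_atTop 0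
    filter_upwards [hev, eventually_gt_atTop 0] with t h2 h3
    rw [← Real.log_div h2.ne' h3.ne']
    congr 1
    field_simp
  have hFl : Tendsto (fun t => F t - (∑ k, g k * l k) * Real.log t) atTop
      (𝓝 (∑ k, g k * l k * Real.log (l k))) := by
    simp only [hF, Finset.sum_mul, ← Finset.sum_sub_distrib, ← mul_sub]
    refine tendsto_finsetSum _ fun k _ => ?_
    rcases (hl k).eq_or_lt with h0 | h0
    · simp [← h0]
    · exact (key 1 (l k) h0).const_mul _
  have hGl : Tendsto (fun t => G t - (∑ k, g k * l k) * Real.log t) atTop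
      (𝓝 (∑ i, w i * a i * (Real.log (a i) - Real.log (b i)))) := by
    rw [hsum]
    simp only [hG, Finset.sum_mul, ← Finset.sum_sub_distrib, ← mul_sub]
    refine tendsto_finsetSum _ fun i _ => ?_
    rcases (ha i).eq_or_lt with h0 | h0
    · simp [← h0]
    · refine Tendsto.const_mul _ ?_
      simp only [sub_right_comm]
      exact (key (b i) (a i) h0).sub_const _
  refine le_of_tendsto_of_tendsto hFl hGl ?_
  filter_upwards [eventually_gt_atTop 0] with t ht
  exact sub_le_sub_right (hle t ht) _

theorem trace_conj_diagonal_mul_star {n m l : Type*} [Fintype n] [Fintype m] [Fintype l]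
    [DecidableEq m] [DecidableEq n]
    (V : Matrix n l ℂ) (d : l → ℝ) (U : Matrix n m ℂ) (hU : U * Uᴴ = 1) (Y : Matrix n n ℂ)
    [DecidableEq l] :
    (V * diagonal (fun j => (d j : ℂ)) * Vᴴ * (Y * Yᴴ)).trace.re =
      ∑ j, ∑ i, d j * Complex.normSq ((Vᴴ * Y * U) j i) := by
  have h : (V * diagonal (fun j => (d j : ℂ)) * Vᴴ * (Y * Yᴴ)).trace =
      (diagonal (fun j => (d j : ℂ)) * ((Vᴴ * Y * U) * (Vᴴ * Y * U)ᴴ)).trace := by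
    have : (Vᴴ * Y * U) * (Vᴴ * Y * U)ᴴ = Vᴴ * Y * (U * Uᴴ) * Yᴴ * V := by
      simp only [conjTranspose_mul, conjTranspose_conjTranspose, Matrix.mul_assoc]
    rw [this, hU, Matrix.mul_one, Matrix.mul_assoc, Matrix.mul_assoc, Matrix.trace_mul_comm]
    simp only [Matrix.mul_assoc]
  rw [h, trace, Complex.re_sum]
  refine Finset.sum_congr rfl fun j _ => ?_
  rw [diag_apply, diagonal_mul, Complex.re_ofReal_mul, mul_apply, Complex.re_sum, Finset.mul_sum]
  refine Finset.sum_congr rfl fun i _ => ?_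
  rw [conjTranspose_apply, Complex.star_def, Complex.mul_conj, Complex.ofReal_re]

/-- Variational bound for the resolvent form of the relative entropy of the matrices with spectral
decompositions `U diag(a) Uᴴ` and `V diag(b) Vᴴ`. -/
theorem trace_variational_le_resolvent {n m l : Type*} [Fintype n] [Fintype m] [Fintype l]
    [DecidableEq n] [DecidableEq m] [DecidableEq l]
    (U : Matrix n m ℂ) (V : Matrix n l ℂ) (hU : U * Uᴴ = 1) (hV : V * Vᴴ = 1)
    (a : m → ℝ) (b : l → ℝ) (ha : ∀ i, 0 ≤ a i) (hb : ∀ j, 0 ≤ b j) (Y : Matrix n n ℂ)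
    {t : ℝ} (ht : 0 < t) :
    2 * (U * diagonal (fun i => (a i : ℂ)) * Uᴴ * Y).trace.re
      - (V * diagonal (fun j => (b j : ℂ)) * Vᴴ * (Y * Yᴴ)).trace.re
      - t * (U * diagonal (fun i => (a i : ℂ)) * Uᴴ * (Yᴴ * Y)).trace.re ≤
    ∑ p : m × l, Complex.normSq ((Uᴴ * V) p.1 p.2) * a p.1 * (a p.1 / (b p.2 + t * a p.1)) := by
  have h1 : (U * diagonal (fun i => (a i : ℂ)) * Uᴴ * Y).trace.re =
      ∑ i, ∑ j, a i * ((Uᴴ * V) i j * (Vᴴ * Y * U) j i).re := by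
    have h : (U * diagonal (fun i => (a i : ℂ)) * Uᴴ * Y).trace =
        (diagonal (fun i => (a i : ℂ)) * ((Uᴴ * V) * (Vᴴ * Y * U))).trace := by
      have : (Uᴴ * V) * (Vᴴ * Y * U) = Uᴴ * (V * Vᴴ) * Y * U := by
        simp only [Matrix.mul_assoc]
      rw [this, hV, Matrix.mul_one, Matrix.mul_assoc, Matrix.mul_assoc, Matrix.trace_mul_comm]
      simp only [Matrix.mul_assoc]
    rw [h, trace, Complex.re_sum]
    refine Finset.sum_congr rfl fun i _ => ?_
    rw [diag_apply, diagonal_mul, Complex.re_ofReal_mul, mul_apply, Complex.re_sum, Finset.mul_sum]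
  have h2 := trace_conj_diagonal_mul_star V b U hU Y
  have h3 := trace_conj_diagonal_mul_star U a V hV Yᴴ
  rw [conjTranspose_conjTranspose] at h3
  have hZ : ∀ i j, Complex.normSq ((Uᴴ * Yᴴ * V) i j) = Complex.normSq ((Vᴴ * Y * U) j i) := by
    intro i j
    have : Uᴴ * Yᴴ * V = (Vᴴ * Y * U)ᴴ := by
      simp only [conjTranspose_mul, conjTranspose_conjTranspose, Matrix.mul_assoc]
    rw [this, conjTranspose_apply, Complex.star_def, Complex.normSq_conj]
  simp only [hZ] at h3
  rw [h1, h2, h3, Finset.sum_comm (γ := l), Fintype.sum_prod_type, Finset.mul_sum, Finset.mul_sum,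
    ← Finset.sum_sub_distrib, ← Finset.sum_sub_distrib]
  refine Finset.sum_le_sum fun i _ => ?_
  rw [Finset.mul_sum, Finset.mul_sum, ← Finset.sum_sub_distrib, ← Finset.sum_sub_distrib]
  refine Finset.sum_le_sum fun j _ => ?_
  generalize (Uᴴ * V) i j = w
  generalize (Vᴴ * Y * U) j i = z
  rcases (ha i).eq_or_lt with h0 | h0
  · rw [← h0]
    simpa using mul_nonneg (hb j) (Complex.normSq_nonneg z)
  have hpos : 0 < b j + t * a i := by have := hb j; positivity
  rw [← mul_div_assoc, le_div_iff₀ hpos]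
  simp only [Complex.mul_re, Complex.normSq_apply]
  nlinarith [sq_nonneg (a i * w.re - (b j + t * a i) * z.re),
    sq_nonneg (a i * w.im + (b j + t * a i) * z.im)]

theorem trace_mul_conj_diagonal_re {n m : Type*} [Fintype n] [Fintype m] [DecidableEq m]
    (A : Matrix n n ℂ) (W : Matrix n m ℂ) (y : m → ℝ) :
    (A * (W * diagonal (fun k => (y k : ℂ)) * Wᴴ)).trace.re =
      ∑ k, ((Wᴴ * A * W) k k).re * y k := by
  have : (A * (W * diagonal (fun k => (y k : ℂ)) * Wᴴ)).trace =
      (Wᴴ * A * W * diagonal (fun k => (y k : ℂ))).trace := by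
    rw [← Matrix.mul_assoc, Matrix.trace_mul_comm]
    simp only [Matrix.mul_assoc]
  rw [this, trace, Complex.re_sum]
  refine Finset.sum_congr rfl fun k _ => ?_
  rw [diag_apply, mul_diagonal, Complex.re_mul_ofReal]

theorem sum_re_diag_conj {n m : Type*} [Fintype n] [Fintype m] [DecidableEq n]
    (A : Matrix n n ℂ) (W : Matrix n m ℂ) (hW : W * Wᴴ = 1) :
    ∑ k, ((Wᴴ * A * W) k k).re = A.trace.re := by
  rw [← Complex.re_sum]
  change (trace (Wᴴ * A * W)).re = _
  rw [Matrix.trace_mul_cycle, hW, Matrix.one_mul]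

/-- Monotonicity of the relative entropy of `A = U diag(a) Uᴴ` with respect to
`B = V diag(b) Vᴴ` under pinching to the orthonormal basis `W`, when the diagonals of the two
pinched matrices are `γ k * lam k` and `γ k`. -/
theorem pinched_relative_entropy_le {n m l κ : Type*}
    [Fintype n] [Fintype m] [Fintype l] [Fintype κ]
    [DecidableEq n] [DecidableEq m] [DecidableEq l] [DecidableEq κ]
    (A B : Matrix n n ℂ) (U : Matrix n m ℂ) (V : Matrix n l ℂ) (W : Matrix n κ ℂ)
    (hU : U * Uᴴ = 1) (hV : V * Vᴴ = 1) (hU' : Uᴴ * U = 1)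
    (hW : W * Wᴴ = 1) (hW' : Wᴴ * W = 1)
    (a : m → ℝ) (b : l → ℝ) (ha : ∀ i, 0 ≤ a i) (hb : ∀ j, 0 ≤ b j)
    (hA : A = U * diagonal (fun i => (a i : ℂ)) * Uᴴ)
    (hB : B = V * diagonal (fun j => (b j : ℂ)) * Vᴴ)
    (q : l → ℝ) (hq : ∀ j, ((Vᴴ * A * V) j j).re = q j) (hsupp : ∀ j, b j = 0 → q j = 0)
    (γ lam : κ → ℝ) (hlam : ∀ k, 0 ≤ lam k)
    (hWA : ∀ k, ((Wᴴ * A * W) k k).re = γ k * lam k)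
    (hWB : ∀ k, ((Wᴴ * B * W) k k).re = γ k) :
    ∑ k, γ k * lam k * Real.log (lam k) ≤
      ∑ i, a i * Real.log (a i) - ∑ j, q j * Real.log (b j) := by
  set c : m → l → ℝ := fun i j => Complex.normSq ((Uᴴ * V) i j) with hc
  have hcol : ∀ j, ∑ i, c i j * a i = q j := by
    intro j
    have h : Vᴴ * A * V = (Uᴴ * V)ᴴ * (diagonal (fun i => (a i : ℂ)) * (Uᴴ * V)) := by
      rw [hA]
      simp only [conjTranspose_mul, conjTranspose_conjTranspose, Matrix.mul_assoc]
    rw [← hq j, h, mul_apply, Complex.re_sum]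
    refine Finset.sum_congr rfl fun i _ => ?_
    rw [diagonal_mul, conjTranspose_apply, Complex.star_def, mul_left_comm, Complex.conj_mul',
      ← Complex.ofReal_pow, ← Complex.ofReal_mul, Complex.ofReal_re, mul_comm,
      ← Complex.normSq_eq_norm_sq]
  have hrow : ∀ i, ∑ j, c i j = 1 := by
    intro i
    have h : (Uᴴ * V) * (Uᴴ * V)ᴴ = 1 := by
      rw [conjTranspose_mul, conjTranspose_conjTranspose, Matrix.mul_assoc, ← Matrix.mul_assoc V,
        hV, Matrix.one_mul, hU']
    have h' := congrArg Complex.re (congrFun (congrFun h i) i)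
    rw [one_apply_eq, mul_apply, Complex.re_sum, Complex.one_re] at h'
    rw [← h']
    refine Finset.sum_congr rfl fun j _ => ?_
    rw [conjTranspose_apply, Complex.star_def, Complex.mul_conj, Complex.ofReal_re]
  have hcnn : ∀ i j, 0 ≤ c i j := fun i j => Complex.normSq_nonneg _
  have hsum : ∑ k, γ k * lam k = ∑ p : m × l, c p.1 p.2 * a p.1 := by
    rw [Fintype.sum_prod_type_right, Finset.sum_congr rfl fun j _ => hcol j]
    simp only [← hq, ← hWA]
    rw [sum_re_diag_conj A W hW, sum_re_diag_conj A V hV]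
  have main := sum_mul_log_le_of_resolvent_le γ lam (fun p : m × l => c p.1 p.2)
    (fun p => a p.1) (fun p => b p.2) hlam (fun p => ha p.1) (fun p => hb p.2) hsum ?_ ?_
  · refine main.trans (le_of_eq ?_)
    simp only [mul_sub, Finset.sum_sub_distrib]
    congr 1
    · rw [Fintype.sum_prod_type]
      refine Finset.sum_congr rfl fun i _ => ?_
      simp only [mul_assoc]
      rw [← Finset.sum_mul, hrow, one_mul]
    · rw [Fintype.sum_prod_type_right]
      refine Finset.sum_congr rfl fun j _ => ?_
      rw [← hcol, Finset.sum_mul]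
  · rintro ⟨i, j⟩ h0
    have := hcol j
    rw [hsupp j h0, Finset.sum_eq_zero_iff_of_nonneg
      fun i _ => mul_nonneg (hcnn i j) (ha i)] at this
    exact this i (Finset.mem_univ i)
  · intro t ht
    set y : κ → ℝ := fun k => lam k / (1 + t * lam k) with hy
    set Y : Matrix n n ℂ := W * diagonal (fun k => (y k : ℂ)) * Wᴴ with hY
    have hYstar : Yᴴ = Y := by
      simp only [hY, conjTranspose_mul, conjTranspose_conjTranspose, diagonal_conjTranspose,
        Matrix.mul_assoc]
      congr 3
      ext k
      simp
    have hYY : Y * Y = W * diagonal (fun k => ((y k ^ 2 : ℝ) : ℂ)) * Wᴴ := by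
      have : Y * Y = W * (diagonal (fun k => (y k : ℂ)) * (Wᴴ * W) *
          diagonal (fun k => (y k : ℂ))) * Wᴴ := by
        simp only [hY, Matrix.mul_assoc]
      rw [this, hW', Matrix.mul_one, diagonal_mul_diagonal]
      simp only [pow_two, Complex.ofReal_mul]
    have h := trace_variational_le_resolvent U V hU hV a b ha hb Y ht
    rw [← hA, ← hB, hYstar, hYY, hY, trace_mul_conj_diagonal_re, trace_mul_conj_diagonal_re,
      trace_mul_conj_diagonal_re, Finset.mul_sum, Finset.mul_sum, ← Finset.sum_sub_distrib,
      ← Finset.sum_sub_distrib] at h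
    refine le_trans (le_of_eq ?_) h
    refine Finset.sum_congr rfl fun k _ => ?_
    have hpos : 1 + t * lam k ≠ 0 := by have := mul_nonneg ht.le (hlam k); positivity
    have hyk : y k * (1 + t * lam k) = lam k := div_mul_cancel₀ _ hpos
    rw [hWA, hWB]
    change γ k * lam k * y k = _
    linear_combination γ k * y k * hyk

/-- The isometry `|a⟩|c⟩ ↦ |a⟩|u⟩|c⟩` inserting the vector `u` in the factor B. -/
def embB (u : Q2 → ℂ) : Matrix Q3 Q4 ℂ :=
  fun x y => if x.1 = y.1 ∧ x.2.2 = y.2 then u x.2.1 else 0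

theorem embB_conjTranspose_mul (u v : Q2 → ℂ) :
    (embB u)ᴴ * embB v = (star u ⬝ᵥ v) • (1 : Matrix Q4 Q4 ℂ) := by
  ext ⟨a, c⟩ ⟨a', c'⟩
  fin_cases a <;> fin_cases c <;> fin_cases a' <;> fin_cases c' <;>
    simp [embB, mul_apply, Fintype.sum_prod_type, dotProduct]

theorem embB_mul_conjTranspose (u : Q2 → ℂ) : embB u * (embB u)ᴴ = opB (proj u) := by
  ext ⟨a, b, c⟩ ⟨a', b', c'⟩
  fin_cases a <;> fin_cases c <;> fin_cases a' <;> fin_cases c' <;>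
    simp [embB, opB, proj, mul_apply, Fintype.sum_prod_type]

theorem rhoAC_embB_conj (u : Q2 → ℂ) (N : Matrix Q4 Q4 ℂ) :
    rhoAC (embB u * N * (embB u)ᴴ) = (star u ⬝ᵥ u) • N := by
  ext ⟨a, c⟩ ⟨a', c'⟩
  fin_cases a <;> fin_cases c <;> fin_cases a' <;> fin_cases c' <;>
    simp [rhoAC, embB, mul_apply, Fintype.sum_prod_type, dotProduct] <;> ring

theorem opB_mul_embB (π : Matrix Q2 Q2 ℂ) (u : Q2 → ℂ) :
    opB π * embB u = embB (π *ᵥ u) := by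
  ext ⟨a, b, c⟩ ⟨a', c'⟩
  fin_cases a <;> fin_cases c <;> fin_cases a' <;> fin_cases c' <;>
    simp [opB, embB, mul_apply, Fintype.sum_prod_type, mulVec, dotProduct]

theorem opB_eq_kronecker (π : Matrix Q2 Q2 ℂ) :
    opB π = kronecker (1 : Matrix Q2 Q2 ℂ) (kronecker π (1 : Matrix Q2 Q2 ℂ)) := by
  ext ⟨a, b, c⟩ ⟨a', b', c'⟩
  simp only [opB, kronecker, kroneckerMap_apply, one_apply, mul_assoc]

theorem opB_mul (π σ : Matrix Q2 Q2 ℂ) : opB π * opB σ = opB (π * σ) := by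
  simp only [opB_eq_kronecker, kronecker, ← mul_kronecker_mul, Matrix.mul_one]

theorem opB_conjTranspose (π : Matrix Q2 Q2 ℂ) : (opB π)ᴴ = opB πᴴ := by
  simp only [opB_eq_kronecker, kronecker, conjTranspose_kronecker, conjTranspose_one]

theorem opB_one : opB 1 = 1 := by
  simp only [opB_eq_kronecker, kronecker, one_kronecker_one]

theorem opB_diagonal (d : Q2 → ℂ) : opB (diagonal d) = diagonal fun x : Q3 => d x.2.1 := by
  simp only [opB_eq_kronecker, kronecker, ← diagonal_one, diagonal_kronecker_diagonal, one_mul,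
    mul_one]

theorem rhoB_opB_mul (π : Matrix Q2 Q2 ℂ) (ρ : Matrix Q3 Q3 ℂ) :
    rhoB (opB π * ρ) = π * rhoB ρ := by
  ext b b'
  simp [rhoB, opB, mul_apply, Fintype.sum_prod_type]
  ring

theorem rhoB_mul_opB (π : Matrix Q2 Q2 ℂ) (ρ : Matrix Q3 Q3 ℂ) :
    rhoB (ρ * opB π) = rhoB ρ * π := by
  ext b b'
  simp [rhoB, opB, mul_apply, Fintype.sum_prod_type]
  ring

theorem trace_rhoB (ρ : Matrix Q3 Q3 ℂ) : (rhoB ρ).trace = ρ.trace := by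
  simp [rhoB, trace, Fintype.sum_prod_type]
  ring

theorem rhoB_posSemidef {ρ : Matrix Q3 Q3 ℂ} (hρ : ρ.PosSemidef) : (rhoB ρ).PosSemidef := by
  have : rhoB ρ = ∑ a, ∑ c, ρ.submatrix (fun b => (a, b, c)) (fun b => (a, b, c)) := by
    ext b b'
    simp [rhoB, Matrix.sum_apply]
  rw [this]
  exact posSemidef_sum _ fun a _ => posSemidef_sum _ fun c _ => hρ.submatrix _

theorem trace_proj_mul {n : Type*} [Fintype n] (u : n → ℂ) (M : Matrix n n ℂ) :
    (proj u * M).trace = star u ⬝ᵥ M *ᵥ u := by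
  change (vecMulVec u (star u) * M).trace = _
  rw [vecMulVec_mul, trace_vecMulVec, dotProduct_comm, dotProduct_mulVec]

theorem pB_eq (ρ : Matrix Q3 Q3 ℂ) (u : Fin 2 → Q2 → ℂ) (j : Fin 2) :
    pB ρ u j = (star (u j) ⬝ᵥ rhoB ρ *ᵥ u j).re := by
  rw [pB, ← trace_rhoB, rhoB_opB_mul, trace_proj_mul]

theorem pB_eq_trace (ρ : Matrix Q3 Q3 ℂ) (u : Fin 2 → Q2 → ℂ) (j : Fin 2) :
    pB ρ u j = ((embB (u j))ᴴ * ρ * embB (u j)).trace.re := by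
  rw [pB, Matrix.trace_mul_cycle, embB_mul_conjTranspose]

theorem embB_conj_opB (u : Q2 → ℂ) (π : Matrix Q2 Q2 ℂ) :
    (embB u)ᴴ * opB π * embB u = (star u ⬝ᵥ π *ᵥ u) • (1 : Matrix Q4 Q4 ℂ) := by
  rw [Matrix.mul_assoc, opB_mul_embB, embB_conjTranspose_mul]

theorem condAC_eq (ρ : Matrix Q3 Q3 ℂ) (u : Fin 2 → Q2 → ℂ) (hu : OrthonormalFamily u)
    (j : Fin 2) :
    condAC ρ u j = ((pB ρ u j : ℂ))⁻¹ • ((embB (u j))ᴴ * ρ * embB (u j)) := by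
  have h1 : star (u j) ⬝ᵥ u j = 1 := by simpa [dotProduct] using hu j j
  have h2 : embB (u j) * (embB (u j))ᴴ * ρ * (embB (u j) * (embB (u j))ᴴ) =
      embB (u j) * ((embB (u j))ᴴ * ρ * embB (u j)) * (embB (u j))ᴴ := by
    simp only [Matrix.mul_assoc]
  rw [condAC, ← embB_mul_conjTranspose, h2, rhoAC_embB_conj, h1, one_smul]

theorem pB_nonneg {ρ : Matrix Q3 Q3 ℂ} (hρ : ρ.PosSemidef) (u : Fin 2 → Q2 → ℂ) (j : Fin 2) :
    0 ≤ pB ρ u j := by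
  rw [pB_eq_trace]
  exact (Complex.nonneg_iff.1 (hρ.conjTranspose_mul_mul_same (embB (u j))).trace_nonneg).1

theorem condAC_posSemidef {ρ : Matrix Q3 Q3 ℂ} (hρ : ρ.PosSemidef) (u : Fin 2 → Q2 → ℂ)
    (hu : OrthonormalFamily u) (j : Fin 2) : (condAC ρ u j).PosSemidef := by
  rw [condAC_eq ρ u hu, ← Complex.ofReal_inv]
  refine (hρ.conjTranspose_mul_mul_same (embB (u j))).smul ?_
  exact Complex.zero_le_real.2 (inv_nonneg.2 (pB_nonneg hρ u j))

theorem embB_conj_eq_pB_smul_condAC {ρ : Matrix Q3 Q3 ℂ} (hρ : ρ.PosSemidef)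
    (u : Fin 2 → Q2 → ℂ) (hu : OrthonormalFamily u) (j : Fin 2) :
    (embB (u j))ᴴ * ρ * embB (u j) = (pB ρ u j : ℂ) • condAC ρ u j := by
  have hN := hρ.conjTranspose_mul_mul_same (embB (u j))
  rw [condAC_eq ρ u hu]
  by_cases hp : pB ρ u j = 0
  · have h0 : ((embB (u j))ᴴ * ρ * embB (u j)).trace = 0 := by
      refine Complex.ext ?_ (Complex.nonneg_iff.1 hN.trace_nonneg).2.symm
      rw [← pB_eq_trace, hp, Complex.zero_re]
    rw [hN.trace_eq_zero_iff.1 h0, smul_zero, smul_zero]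
  · rw [smul_smul, mul_inv_cancel₀ (Complex.ofReal_ne_zero.2 hp), one_smul]

theorem isHermitian_eq_conj_diagonal {n : Type*} [Fintype n] [DecidableEq n] {A : Matrix n n ℂ}
    (hA : A.IsHermitian) :
    A = (hA.eigenvectorUnitary : Matrix n n ℂ) * diagonal (fun i => (hA.eigenvalues i : ℂ)) *
      (hA.eigenvectorUnitary : Matrix n n ℂ)ᴴ :=
  hA.spectral_theorem

theorem conj_eigenvectorUnitary {n : Type*} [Fintype n] [DecidableEq n] {A : Matrix n n ℂ}
    (hA : A.IsHermitian) :
    (hA.eigenvectorUnitary : Matrix n n ℂ)ᴴ * A * (hA.eigenvectorUnitary : Matrix n n ℂ) =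
      diagonal (fun i => (hA.eigenvalues i : ℂ)) := by
  have := hA.conjStarAlgAut_star_eigenvectorUnitary
  rwa [Unitary.conjStarAlgAut_star_apply] at this

theorem vN_eq_s14 {n : Type*} [Fintype n] [DecidableEq n] {A : Matrix n n ℂ} (hA : A.IsHermitian) :
    vN A = -∑ i, hA.eigenvalues i * Real.log (hA.eigenvalues i) := by
  rw [vN, dif_pos hA, ← Finset.sum_neg_distrib]
  simp only [Real.negMulLog, neg_mul]

/-- The product basis `x_{jk} ⊗ u_j`, where `x_{jk}` is the `k`-th column of `X j`. -/
def measBasis (u : Fin 2 → Q2 → ℂ) (X : Fin 2 → Matrix Q4 Q4 ℂ) : Matrix Q3 (Fin 2 × Q4) ℂ :=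
  fun x p => (embB (u p.1) * X p.1) x p.2

theorem measBasis_conj_apply (u : Fin 2 → Q2 → ℂ) (X : Fin 2 → Matrix Q4 Q4 ℂ)
    (M : Matrix Q3 Q3 ℂ) (p q : Fin 2 × Q4) :
    ((measBasis u X)ᴴ * M * measBasis u X) p q =
      ((X p.1)ᴴ * ((embB (u p.1))ᴴ * M * embB (u q.1)) * X q.1) p.2 q.2 := by
  have h : ((measBasis u X)ᴴ * M * measBasis u X) p q =
      ((embB (u p.1) * X p.1)ᴴ * M * (embB (u q.1) * X q.1)) p.2 q.2 := by
    rw [mul_apply, mul_apply]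
    refine Finset.sum_congr rfl fun y _ => ?_
    rw [mul_apply, mul_apply]
    rfl
  rw [h]
  simp only [conjTranspose_mul, Matrix.mul_assoc]

theorem measBasis_isometry (u : Fin 2 → Q2 → ℂ) (hu : OrthonormalFamily u)
    (X : Fin 2 → Matrix Q4 Q4 ℂ) (hX : ∀ j, (X j)ᴴ * X j = 1) :
    (measBasis u X)ᴴ * measBasis u X = 1 := by
  ext ⟨i, k⟩ ⟨j, k'⟩
  have h := measBasis_conj_apply u X 1 (i, k) (j, k')
  have hd : star (u i) ⬝ᵥ u j = if i = j then 1 else 0 := by simpa [dotProduct] using hu i j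
  rw [Matrix.mul_one, Matrix.mul_one, embB_conjTranspose_mul, hd] at h
  rw [h]
  by_cases hij : i = j
  · subst hij
    simp [hX, one_apply]
  · simp [hij]

theorem opB_eq_conj_diagonal {M : Matrix Q2 Q2 ℂ} (hM : M.IsHermitian) :
    opB M = opB (hM.eigenvectorUnitary : Matrix Q2 Q2 ℂ) *
      diagonal (fun x : Q3 => ((hM.eigenvalues x.2.1 : ℝ) : ℂ)) *
      (opB (hM.eigenvectorUnitary : Matrix Q2 Q2 ℂ))ᴴ := by
  rw [← opB_diagonal fun b => (hM.eigenvalues b : ℂ), opB_conjTranspose, opB_mul, opB_mul]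
  exact congrArg opB (isHermitian_eq_conj_diagonal hM)

theorem rhoB_conj_eigenvectorUnitary {ρ : Matrix Q3 Q3 ℂ} (hB : (rhoB ρ).IsHermitian) :
    rhoB ((opB (hB.eigenvectorUnitary : Matrix Q2 Q2 ℂ))ᴴ * ρ *
      opB (hB.eigenvectorUnitary : Matrix Q2 Q2 ℂ)) =
      diagonal fun i => (hB.eigenvalues i : ℂ) := by
  rw [rhoB_mul_opB, opB_conjTranspose, rhoB_opB_mul]
  exact conj_eigenvectorUnitary hB

/-- For a three-qubit density matrix and a rank-one projective measurement on B,
measuring B cannot decrease the conditional entropy of AC given B: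
`∑_{j: pⱼ>0} pⱼ S(ρ_{AC|j}) ≥ S(ρ_ABC) − S(ρ_B)`. -/
theorem measurement_on_B_cannot_decrease_conditional_entropy
    (ρ : Matrix Q3 Q3 ℂ) (hρ : IsDensityMatrix ρ)
    (u : Fin 2 → Q2 → ℂ) (hu : OrthonormalFamily u) :
    vN ρ - vN (rhoB ρ) ≤ ∑ j, if 0 < pB ρ u j then pB ρ u j * vN (condAC ρ u j) else 0 := by
  have hps := hρ.1
  have hBps := rhoB_posSemidef hps
  have hA := hps.isHermitian
  have hB := hBps.isHermitian
  have hCps := condAC_posSemidef hps u hu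
  have hC : ∀ j, (condAC ρ u j).IsHermitian := fun j => (hCps j).isHermitian
  obtain ⟨v, hv⟩ : ∃ v : Matrix Q2 Q2 ℂ, v = hB.eigenvectorUnitary := ⟨_, rfl⟩
  have hv1 : v * vᴴ = 1 := by
    rw [hv]
    exact Unitary.coe_mul_star_self hB.eigenvectorUnitary
  obtain ⟨X, hX⟩ : ∃ X : Fin 2 → Matrix Q4 Q4 ℂ, ∀ j, X j = (hC j).eigenvectorUnitary :=
    ⟨_, fun _ => rfl⟩
  have hX1 : ∀ j, (X j)ᴴ * X j = 1 := by
    intro j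
    rw [hX]
    exact Unitary.coe_star_mul_self (hC j).eigenvectorUnitary
  have hWW := measBasis_isometry u hu X hX1
  have hWW' : measBasis u X * (measBasis u X)ᴴ = 1 := (mul_eq_one_comm_of_card_eq _ _ _ (by simp)).1 hWW
  obtain ⟨q, hq⟩ : ∃ q : Q3 → ℝ, ∀ x, (((opB v)ᴴ * ρ * opB v) x x).re = q x :=
    ⟨_, fun _ => rfl⟩
  have hqnn : ∀ x, 0 ≤ q x := fun x => hq x ▸
    (Complex.nonneg_iff.1 (hps.conjTranspose_mul_mul_same (opB v)).diag_nonneg).1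
  have hqsum : ∀ b, ∑ a, ∑ c, q (a, b, c) = hB.eigenvalues b := by
    intro b
    have h := rhoB_conj_eigenvectorUnitary hB
    rw [← hv] at h
    have h' := congrArg Complex.re (congrFun (congrFun h b) b)
    rw [diagonal_apply_eq, Complex.ofReal_re] at h'
    rw [← h']
    simp only [rhoB, Complex.re_sum, hq]
  have hBop := opB_eq_conj_diagonal hB
  rw [← hv] at hBop
  have hV : opB v * (opB v)ᴴ = 1 := by rw [opB_conjTranspose, opB_mul, hv1, opB_one]
  obtain ⟨U, hU⟩ : ∃ U : Matrix Q3 Q3 ℂ, U = hA.eigenvectorUnitary := ⟨_, rfl⟩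
  have hU1 : U * Uᴴ = 1 := by
    rw [hU]
    exact Unitary.coe_mul_star_self hA.eigenvectorUnitary
  have hU2 : Uᴴ * U = 1 := by
    rw [hU]
    exact Unitary.coe_star_mul_self hA.eigenvectorUnitary
  have hAdiag := isHermitian_eq_conj_diagonal hA
  rw [← hU] at hAdiag
  have main := pinched_relative_entropy_le ρ (opB (rhoB ρ)) U (opB v) (measBasis u X) hU1 hV hU2
    hWW' hWW hA.eigenvalues (fun x => hB.eigenvalues x.2.1) hps.eigenvalues_nonneg
    (fun x => hBps.eigenvalues_nonneg x.2.1) hAdiag hBop q hq ?_ (fun p => pB ρ u p.1)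
    (fun p => (hC p.1).eigenvalues p.2) (fun p => (hCps p.1).eigenvalues_nonneg p.2) ?_ ?_
  · have hR : ∑ x : Q3, q x * Real.log (hB.eigenvalues x.2.1) =
        ∑ b, hB.eigenvalues b * Real.log (hB.eigenvalues b) := by
      simp only [Fintype.sum_prod_type]
      rw [Finset.sum_comm]
      refine Finset.sum_congr rfl fun b _ => ?_
      simp only [← Finset.sum_mul, hqsum]
    have hS : (∑ j, if 0 < pB ρ u j then pB ρ u j * vN (condAC ρ u j) else 0) =
        -∑ p : Fin 2 × Q4, pB ρ u p.1 * (hC p.1).eigenvalues p.2 *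
          Real.log ((hC p.1).eigenvalues p.2) := by
      rw [Fintype.sum_prod_type, ← Finset.sum_neg_distrib]
      refine Finset.sum_congr rfl fun j _ => ?_
      simp only [mul_assoc, ← Finset.mul_sum]
      split_ifs with hp
      · rw [vN_eq_s14 (hC j), mul_neg]
      · rw [le_antisymm (not_lt.1 hp) (pB_nonneg hps u j), zero_mul, neg_zero]
    rw [hS, vN_eq_s14 hA, vN_eq_s14 hB]
    rw [hR] at main
    linarith
  · rintro ⟨a, b, c⟩ h0
    have h := hqsum b
    rw [h0, Finset.sum_eq_zero_iff_of_nonneg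
      fun a _ => Finset.sum_nonneg fun c _ => hqnn (a, b, c)] at h
    exact (Finset.sum_eq_zero_iff_of_nonneg fun c _ => hqnn (a, b, c)).1
      (h a (Finset.mem_univ a)) c (Finset.mem_univ c)
  · rintro ⟨j, k⟩
    rw [measBasis_conj_apply, embB_conj_eq_pB_smul_condAC hps u hu, Matrix.mul_smul, Matrix.smul_mul, hX,
      conj_eigenvectorUnitary (hC j)]
    simp
  · rintro ⟨j, k⟩
    rw [measBasis_conj_apply, embB_conj_opB, Matrix.mul_smul, Matrix.smul_mul, Matrix.mul_one, hX1, pB_eq]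
    simp
end
end
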